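/- Let q ∈ (0,1), c > 0, and ν, g ∈ ℝ, and set â = c√(1-q) and b̂ = (√q · g - ν)/√(1-q). Let h be a standard Gaussian random variable. Then E[ exp( c ( -2 min( √(1-q) h + √q g - ν, 0 ) + √(1-q) h + √q g ) ) ] = e^{c√q·g} · (1/2) e^{â²/2} ( erf( (â + b̂)/√2 ) + 1 ) + e^{-c√q·g + 2cν} · (1/2) e^{â²/2} ( erf( (â - b̂)/√2 ) + 1 ). -/

import Mathlib

open Real

/-- The Gauss error function `erf(x) = (2/√π) ∫₀ˣ e^{-t²} dt`. -/
noncomputable def erf (x : ℝ) : ℝ :=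
  (2 / Real.sqrt Real.pi) * ∫ t in (0 : ℝ)..x, Real.exp (-t ^ 2)

lemma aux_gint : MeasureTheory.Integrable (fun t : ℝ => Real.exp (-t ^ 2)) := by
  simpa using integrable_exp_neg_mul_sq (b := 1) one_pos

lemma aux_Iio (x : ℝ) : ∫ t in Set.Iio x, Real.exp (-t ^ 2) = Real.sqrt Real.pi / 2 * (erf x + 1) := by
  have h0 : ∫ t in Set.Iic (0:ℝ), Real.exp (-t ^ 2) = Real.sqrt Real.pi / 2 := by
    have h1 := integral_comp_neg_Ioi (0:ℝ) (fun t : ℝ => Real.exp (-t ^ 2))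
    have h2 := integral_gaussian_Ioi 1
    simp at h1 h2
    rw [← h1, h2]
  have h3 := intervalIntegral.integral_Iic_sub_Iic (a := 0) (b := x) (μ := MeasureTheory.volume)
    (f := fun t : ℝ => Real.exp (-t ^ 2)) aux_gint.integrableOn aux_gint.integrableOn
  rw [← MeasureTheory.integral_Iic_eq_integral_Iio, erf, ← h3, h0]
  have : Real.sqrt Real.pi ≠ 0 := by positivity
  field_simp
  ring

lemma aux_sq (a h : ℝ) : Real.exp (a * h) * ((1 / Real.sqrt (2 * Real.pi)) * Real.exp (-h ^ 2 / 2))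
    = (1 / Real.sqrt (2 * Real.pi)) * Real.exp (a ^ 2 / 2) *
      Real.exp (-((a - h) / Real.sqrt 2) ^ 2) := by
  have e : Real.exp (a * h) * Real.exp (-h ^ 2 / 2)
      = Real.exp (a ^ 2 / 2) * Real.exp (-((a - h) / Real.sqrt 2) ^ 2) := by
    rw [← Real.exp_add, ← Real.exp_add, div_pow, Real.sq_sqrt (by norm_num)]
    congr 1; ring
  linear_combination (1 / Real.sqrt (2 * Real.pi)) * e

lemma aux_int (a : ℝ) : MeasureTheory.Integrable (fun h : ℝ =>
    Real.exp (a * h) * ((1 / Real.sqrt (2 * Real.pi)) * Real.exp (-h ^ 2 / 2))) := by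
  simp_rw [aux_sq]
  apply MeasureTheory.Integrable.const_mul
  exact (aux_gint.comp_div (by positivity : Real.sqrt 2 ≠ 0)).comp_sub_left a

lemma aux_tail (a b : ℝ) : ∫ h in Set.Ioi (-b),
    Real.exp (a * h) * ((1 / Real.sqrt (2 * Real.pi)) * Real.exp (-h ^ 2 / 2))
    = (1 / 2) * Real.exp (a ^ 2 / 2) * (erf ((a + b) / Real.sqrt 2) + 1) := by
  have s2 : 0 < Real.sqrt 2 := by positivity
  simp_rw [aux_sq]
  rw [MeasureTheory.integral_const_mul, ← MeasureTheory.integral_indicator measurableSet_Ioi]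
  set H : ℝ → ℝ := Set.indicator (Set.Iio ((a + b) / Real.sqrt 2)) (fun t => Real.exp (-t ^ 2)) with hH
  have e : (Set.indicator (Set.Ioi (-b)) fun h : ℝ => Real.exp (-((a - h) / Real.sqrt 2) ^ 2))
      = fun h => H ((a - h) / Real.sqrt 2) := by
    funext h
    simp only [hH, Set.indicator, Set.mem_Ioi, Set.mem_Iio, div_lt_div_iff_of_pos_right s2]
    congr 1
    apply propext
    constructor <;> intro <;> linarith
  rw [e, MeasureTheory.integral_sub_left_eq_self (fun t => H (t / Real.sqrt 2)) MeasureTheory.volume a,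
    MeasureTheory.Measure.integral_comp_div, hH, MeasureTheory.integral_indicator measurableSet_Iio,
    aux_Iio, abs_of_pos s2, smul_eq_mul, Real.sqrt_mul (by norm_num)]
  have : Real.sqrt Real.pi ≠ 0 := by positivity
  field_simp

lemma aux_tail' (a b : ℝ) : ∫ h in Set.Iic (-b),
    Real.exp (-a * h) * ((1 / Real.sqrt (2 * Real.pi)) * Real.exp (-h ^ 2 / 2))
    = (1 / 2) * Real.exp (a ^ 2 / 2) * (erf ((a - b) / Real.sqrt 2) + 1) := by
  have h1 := integral_comp_neg_Iic (-b) (fun h : ℝ =>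
    Real.exp (a * h) * ((1 / Real.sqrt (2 * Real.pi)) * Real.exp (-h ^ 2 / 2)))
  rw [aux_tail] at h1
  rw [sub_eq_add_neg, ← h1]
  simp

/-- For `q ∈ (0,1)`, `c > 0`, `ν, g ∈ ℝ`, with `â = c√(1-q)` and
`b̂ = (√q·g - ν)/√(1-q)`, and a standard Gaussian `h`:
`E[ exp( c( -2 min( √(1-q) h + √q g - ν, 0 ) + √(1-q) h + √q g ) ) ]
 = e^{c√q·g}·(1/2) e^{â²/2}( erf((â+b̂)/√2) + 1 )
   + e^{-c√q·g + 2cν}·(1/2) e^{â²/2}( erf((â-b̂)/√2) + 1 )`. -/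
theorem second_level_perceptron_term (q c ν g : ℝ) (hq : q ∈ Set.Ioo (0 : ℝ) 1)
    (hc : 0 < c) (ahat bhat : ℝ)
    (ha : ahat = c * Real.sqrt (1 - q))
    (hb : bhat = (Real.sqrt q * g - ν) / Real.sqrt (1 - q)) :
    (∫ h : ℝ,
        Real.exp (c * (-2 * min (Real.sqrt (1 - q) * h + Real.sqrt q * g - ν) 0 +
          Real.sqrt (1 - q) * h + Real.sqrt q * g)) *
          ((1 / Real.sqrt (2 * Real.pi)) * Real.exp (-h ^ 2 / 2))) =
      Real.exp (c * Real.sqrt q * g) *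
          ((1 / 2) * Real.exp (ahat ^ 2 / 2) * (erf ((ahat + bhat) / Real.sqrt 2) + 1)) +
        Real.exp (-(c * Real.sqrt q * g) + 2 * c * ν) *
          ((1 / 2) * Real.exp (ahat ^ 2 / 2) * (erf ((ahat - bhat) / Real.sqrt 2) + 1)) := by
  have hs : 0 < Real.sqrt (1 - q) := Real.sqrt_pos.2 (by linarith [hq.2])
  have hbs : Real.sqrt (1 - q) * bhat = Real.sqrt q * g - ν := by
    rw [hb]; field_simp
  set s := Real.sqrt (1 - q) with hsdef
  set r := Real.sqrt q with hr
  set F : ℝ → ℝ := fun h => Real.exp (c * (-2 * min (s * h + r * g - ν) 0 + s * h + r * g)) *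
          ((1 / Real.sqrt (2 * Real.pi)) * Real.exp (-h ^ 2 / 2)) with hF
  have e1 : Set.EqOn F (fun h => Real.exp (c * r * g) * (Real.exp (ahat * h) *
      ((1 / Real.sqrt (2 * Real.pi)) * Real.exp (-h ^ 2 / 2)))) (Set.Ioi (-bhat)) := by
    intro h hh
    have h0 : 0 ≤ s * (h + bhat) := mul_nonneg hs.le (by linarith [Set.mem_Ioi.1 hh])
    simp only [hF]
    rw [min_eq_right (by linarith), ← mul_assoc (Real.exp (c * r * g)), ← Real.exp_add, ha]
    congr 2; ring
  have e2 : Set.EqOn F (fun h => Real.exp (-(c * r * g) + 2 * c * ν) * (Real.exp (-ahat * h) *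
      ((1 / Real.sqrt (2 * Real.pi)) * Real.exp (-h ^ 2 / 2)))) (Set.Iic (-bhat)) := by
    intro h hh
    have h0 : 0 ≤ s * (-h - bhat) := mul_nonneg hs.le (by linarith [Set.mem_Iic.1 hh])
    simp only [hF]
    rw [min_eq_left (by linarith), ← mul_assoc (Real.exp (-(c * r * g) + 2 * c * ν)),
      ← Real.exp_add, ha]
    congr 2; ring
  have i1 : MeasureTheory.IntegrableOn F (Set.Ioi (-bhat)) :=
    ((aux_int ahat).const_mul _).integrableOn.congr_fun e1.symm measurableSet_Ioi
  have i2 : MeasureTheory.IntegrableOn F (Set.Iic (-bhat)) :=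
    ((aux_int (-ahat)).const_mul _).integrableOn.congr_fun e2.symm measurableSet_Iic
  have key := intervalIntegral.integral_Iic_add_Ioi i2 i1
  rw [← key, MeasureTheory.setIntegral_congr_fun measurableSet_Iic e2,
    MeasureTheory.setIntegral_congr_fun measurableSet_Ioi e1, MeasureTheory.integral_const_mul,
    MeasureTheory.integral_const_mul, aux_tail, aux_tail', add_comm]
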